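/- Let ε ≥ 0, c1 ≥ c2 > 0 with c1 ≤ e^ε·c2, and μ ∈ [0,1] with μ ≥ c2/(2c1). Let ρ ∈ (0,1) and let N be a positive integer with N ≥ 2(e^ε−1)²·ln(2/ρ)/ρ². Let θ := M/N where M ~ Binomial(N, μ). Then E_θ[ KL(π^mrc_θ ‖ π^mmrc_θ) ] ≤ ρ·(1+ε), where KL is the Kullback–Leibler divergence in nats. -/

import Mathlib

open scoped Classical
open Real Finset

noncomputable section

/-- The MRC index distribution for a cap-based mechanism with in-cap values `c1`,
out-cap values `c2`, in-cap index set `S` and in-cap fraction `θ`. -/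
def piMrcGen (c1 c2 θ : ℝ) {N : ℕ} (S : Finset (Fin N)) (k : Fin N) : ℝ :=
  (if k ∈ S then c1 else c2) / ((N : ℝ) * (θ * c1 + (1 - θ) * c2))

/-- The MMRC modification of `piMrcGen`, with cap proportion `μ`,
`a = μ·c1 + (1−μ)·c2`, `t_u = c1/(N·a)`, `t_l = c2/(N·a)`. -/
def piMmrcGen (c1 c2 μ θ : ℝ) {N : ℕ} (S : Finset (Fin N)) (k : Fin N) : ℝ :=
  let a : ℝ := μ * c1 + (1 - μ) * c2
  let tu : ℝ := c1 / ((N : ℝ) * a)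
  let tl : ℝ := c2 / ((N : ℝ) * a)
  if θ < μ then
    (if k ∈ S then tu else (1 - (N : ℝ) * θ * tu) / ((N : ℝ) * (1 - θ)))
  else if μ < θ then
    (if k ∈ S then (1 - (N : ℝ) * (1 - θ) * tl) / ((N : ℝ) * θ) else tl)
  else piMrcGen c1 c2 θ S k

/-- The KL divergence (in nats) between the MRC and MMRC index distributions. -/
def klMrcMmrc (c1 c2 μ θ : ℝ) {N : ℕ} (S : Finset (Fin N)) : ℝ :=
  ∑ k : Fin N,
    piMrcGen c1 c2 θ S k * Real.log (piMrcGen c1 c2 θ S k / piMmrcGen c1 c2 μ θ S k)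

/-- The MRC weights sum to one when the in-cap set has `N * θ` elements. -/
lemma sum_piMrcGen {c1 c2 θ : ℝ} {N : ℕ} (S : Finset (Fin N)) (hN : 0 < N)
    (hθ : (#S : ℝ) = N * θ) (ha : 0 < θ * c1 + (1 - θ) * c2) :
    ∑ k, piMrcGen c1 c2 θ S k = 1 := by
  have hN' : (0 : ℝ) < N := by exact_mod_cast hN
  have hne : (N : ℝ) * (θ * c1 + (1 - θ) * c2) ≠ 0 := by positivity
  have hcompl : (#(univ.filter fun k => k ∉ S) : ℝ) = N * (1 - θ) := by
    have h := Finset.card_filter_add_card_filter_not (s := (univ : Finset (Fin N))) (fun k => k ∈ S)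
    rw [Finset.filter_univ_mem, Finset.card_univ, Fintype.card_fin] at h
    have h' : (#S : ℝ) + #(univ.filter fun k => k ∉ S) = N := by exact_mod_cast h
    linarith
  simp only [piMrcGen]
  rw [← Finset.sum_div, div_eq_one_iff_eq hne, Finset.sum_ite, Finset.sum_const,
    Finset.sum_const, Finset.filter_univ_mem, nsmul_eq_mul, nsmul_eq_mul, hθ, hcompl]
  ring

/-- The pointwise log-likelihood ratio of MRC against MMRC is at most linear in `|θ - μ|`. -/
lemma log_piMrcGen_div_piMmrcGen_le {c1 c2 μ θ D : ℝ} {N : ℕ} (S : Finset (Fin N)) (k : Fin N)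
    (hN : 0 < N) (hc2 : 0 < c2) (hc12 : c2 ≤ c1) (hD : c1 - c2 ≤ D * c2)
    (hμ0 : 0 ≤ μ) (hμ1 : μ ≤ 1) (hμc : c2 / (2 * c1) ≤ μ) (hθ0 : 0 ≤ θ) (hθ1 : θ ≤ 1) :
    Real.log (piMrcGen c1 c2 θ S k / piMmrcGen c1 c2 μ θ S k) ≤ 2 * D * |θ - μ| := by
  have hN' : (0 : ℝ) < N := by exact_mod_cast hN
  have hc1 : 0 < c1 := hc2.trans_le hc12
  have hD0 : 0 ≤ D := nonneg_of_mul_nonneg_left ((sub_nonneg.2 hc12).trans hD) hc2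
  have hB : 0 ≤ 2 * D * |θ - μ| := by positivity
  have hμc' : c2 ≤ 2 * (μ * c1) := by
    rw [div_le_iff₀ (by positivity)] at hμc
    linarith
  have hgap : ∀ ν : ℝ, 0 ≤ ν → c2 ≤ ν * c1 + (1 - ν) * c2 := fun ν h0 => by
    nlinarith [mul_nonneg h0 (sub_nonneg.2 hc12)]
  have haθ := hgap θ hθ0
  have haμ := hgap μ hμ0
  have hpθ : 0 < θ * c1 + (1 - θ) * c2 := hc2.trans_le haθ
  have hpμ : 0 < μ * c1 + (1 - μ) * c2 := hc2.trans_le haμ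
  suffices h : ∃ r, piMrcGen c1 c2 θ S k / piMmrcGen c1 c2 μ θ S k = r ∧ 0 < r ∧
      r ≤ 1 + 2 * D * |θ - μ| by
    obtain ⟨r, hr, h0, h1⟩ := h
    rw [hr]
    linarith [Real.log_le_sub_one_of_pos h0]
  rcases lt_trichotomy θ μ with h | h | h
  · have hθ : 0 < 1 - θ := by linarith
    have habs : |θ - μ| = μ - θ := by rw [abs_of_neg (by linarith)]; ring
    have hd : (μ - θ) * (c1 - c2) ≤ (μ - θ) * (D * c2) :=
      mul_le_mul_of_nonneg_left hD (by linarith)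
    have hDd : 0 ≤ D * (μ - θ) := mul_nonneg hD0 (by linarith)
    by_cases hk : k ∈ S
    · refine ⟨(μ * c1 + (1 - μ) * c2) / (θ * c1 + (1 - θ) * c2), ?_, by positivity, ?_⟩
      · simp only [piMrcGen, piMmrcGen, if_pos hk, if_pos h]
        field_simp
      · rw [div_le_iff₀ hpθ, habs]
        nlinarith [mul_le_mul_of_nonneg_left haθ hDd]
    · have hout : 0 < μ * c1 + (1 - μ) * c2 - θ * c1 := by
        nlinarith [mul_nonneg (sub_nonneg.2 h.le) (sub_nonneg.2 hc12), mul_pos hθ hc2]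
      refine ⟨(1 - θ) * c2 * (μ * c1 + (1 - μ) * c2) /
        ((θ * c1 + (1 - θ) * c2) * (μ * c1 + (1 - μ) * c2 - θ * c1)), ?_, by positivity, ?_⟩
      · have hq : (1 - (N : ℝ) * θ * (c1 / (N * (μ * c1 + (1 - μ) * c2)))) / (N * (1 - θ)) =
            (μ * c1 + (1 - μ) * c2 - θ * c1) / ((μ * c1 + (1 - μ) * c2) * (N * (1 - θ))) := by
          generalize μ * c1 + (1 - μ) * c2 = a at hpμ ⊢
          field_simp
        simp only [piMrcGen, piMmrcGen, if_neg hk, if_pos h]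
        rw [hq]
        field_simp
      · refine le_trans ?_ (le_add_of_nonneg_right hB)
        rw [div_le_one (by positivity)]
        have : 0 ≤ θ * c1 * ((μ - θ) * (c1 - c2)) :=
          mul_nonneg (by positivity) (mul_nonneg (by linarith) (by linarith))
        nlinarith
  · refine ⟨1, ?_, one_pos, le_add_of_nonneg_right hB⟩
    have hp : 0 < piMrcGen c1 c2 θ S k := by
      simp only [piMrcGen]
      split_ifs <;> positivity
    simp only [piMmrcGen, if_neg h.not_lt, if_neg h.symm.not_lt]
    exact div_self hp.ne'
  · have hθ : 0 < θ := by linarith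
    have habs : |θ - μ| = θ - μ := abs_of_pos (by linarith)
    have hd : (θ - μ) * (c1 - c2) ≤ (θ - μ) * (D * c2) :=
      mul_le_mul_of_nonneg_left hD (by linarith)
    have hDd : 0 ≤ D * (θ - μ) := mul_nonneg hD0 (by linarith)
    by_cases hk : k ∈ S
    · have hin : c2 / 2 ≤ μ * c1 + (θ - μ) * c2 := by
        nlinarith [mul_nonneg (sub_nonneg.2 h.le) hc2.le]
      have hin0 : 0 < μ * c1 + (θ - μ) * c2 := by linarith
      refine ⟨θ * c1 * (μ * c1 + (1 - μ) * c2) /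
        ((θ * c1 + (1 - θ) * c2) * (μ * c1 + (θ - μ) * c2)), ?_, by positivity, ?_⟩
      · have hq : (1 - (N : ℝ) * (1 - θ) * (c2 / (N * (μ * c1 + (1 - μ) * c2)))) / (N * θ) =
            (μ * c1 + (θ - μ) * c2) / ((μ * c1 + (1 - μ) * c2) * (N * θ)) := by
          have he : μ * c1 + (θ - μ) * c2 = μ * c1 + (1 - μ) * c2 - (1 - θ) * c2 := by ring
          rw [he]
          generalize μ * c1 + (1 - μ) * c2 = a at hpμ ⊢
          field_simp
        simp only [piMrcGen, piMmrcGen, if_pos hk, if_neg h.not_gt, if_pos h]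
        rw [hq]
        field_simp
      · rw [div_le_iff₀ (by positivity), habs]
        have h1 : (1 - θ) * c2 * ((θ - μ) * (c1 - c2)) ≤
            (θ * c1 + (1 - θ) * c2) * ((θ - μ) * (D * c2)) := by
          apply mul_le_mul _ hd (mul_nonneg (by linarith) (by linarith)) hpθ.le
          linarith [mul_pos hθ hc1]
        have h2 : D * (θ - μ) * (θ * c1 + (1 - θ) * c2) * (c2 / 2) ≤
            D * (θ - μ) * (θ * c1 + (1 - θ) * c2) * (μ * c1 + (θ - μ) * c2) :=
          mul_le_mul_of_nonneg_left hin (mul_nonneg hDd hpθ.le)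
        linarith
    · refine ⟨(μ * c1 + (1 - μ) * c2) / (θ * c1 + (1 - θ) * c2), ?_, by positivity, ?_⟩
      · simp only [piMrcGen, piMmrcGen, if_neg hk, if_neg h.not_gt, if_pos h]
        field_simp
      · refine le_trans ?_ (le_add_of_nonneg_right hB)
        rw [div_le_one hpθ]
        nlinarith [mul_nonneg (sub_nonneg.2 h.le) (sub_nonneg.2 hc12)]

/-- The KL divergence of MRC against MMRC is at most linear in `|θ - μ|`. -/
lemma klMrcMmrc_le {c1 c2 μ θ D : ℝ} {N : ℕ} (S : Finset (Fin N))
    (hN : 0 < N) (hc2 : 0 < c2) (hc12 : c2 ≤ c1) (hD : c1 - c2 ≤ D * c2)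
    (hμ0 : 0 ≤ μ) (hμ1 : μ ≤ 1) (hμc : c2 / (2 * c1) ≤ μ) (hθ0 : 0 ≤ θ) (hθ1 : θ ≤ 1)
    (hS : (#S : ℝ) = N * θ) :
    klMrcMmrc c1 c2 μ θ S ≤ 2 * D * |θ - μ| := by
  have ha : 0 < θ * c1 + (1 - θ) * c2 := by
    nlinarith [mul_nonneg hθ0 (sub_nonneg.2 hc12)]
  have hc1 : 0 < c1 := hc2.trans_le hc12
  calc klMrcMmrc c1 c2 μ θ S
      ≤ ∑ k, piMrcGen c1 c2 θ S k * (2 * D * |θ - μ|) := by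
        refine Finset.sum_le_sum fun k _ => mul_le_mul_of_nonneg_left
          (log_piMrcGen_div_piMmrcGen_le S k hN hc2 hc12 hD hμ0 hμ1 hμc hθ0 hθ1) ?_
        simp only [piMrcGen]
        split_ifs <;> positivity
    _ = 2 * D * |θ - μ| := by rw [← Finset.sum_mul, sum_piMrcGen S hN hS ha, one_mul]

/-- The variance of a rescaled binomial variable. -/
lemma sum_binomial_mul_sq_sub {μ : ℝ} (hμ0 : 0 ≤ μ) (hμ1 : μ ≤ 1) {N : ℕ} (hN : 0 < N) :
    ∑ M ∈ range (N + 1), (N.choose M : ℝ) * μ ^ M * (1 - μ) ^ (N - M) * ((M : ℝ) / N - μ) ^ 2 =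
      μ * (1 - μ) / N := by
  have h := bernstein.variance hN.ne' ⟨μ, hμ0, hμ1⟩
  rw [← h, Finset.sum_range]
  refine Finset.sum_congr rfl fun k _ => ?_
  simp only [bernstein_apply, bernstein.z]
  ring

/-- The total mass of the binomial distribution. -/
lemma sum_binomial (μ : ℝ) (N : ℕ) :
    ∑ M ∈ range (N + 1), (N.choose M : ℝ) * μ ^ M * (1 - μ) ^ (N - M) = 1 := by
  have h := add_pow μ (1 - μ) N
  rw [add_sub_cancel, one_pow] at h
  refine Eq.trans (Finset.sum_congr rfl fun M _ => ?_) h.symm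
  ring

/-- **Lemma B.2.**  If `μ ≥ c2/(2c1)`, `ρ ∈ (0,1)` and `N ≥ 2(e^ε−1)²·ln(2/ρ)/ρ²`, then the
expected KL divergence between the MRC and MMRC index distributions, over the binomial
fraction `θ = M/N` with `M ~ Binomial(N, μ)`, is at most `ρ(1+ε)`. -/
theorem expected_kl_mrc_mmrc_le
    (ε c1 c2 μ : ℝ) (hε : 0 ≤ ε) (hc2 : 0 < c2) (hc12 : c2 ≤ c1)
    (hc1e : c1 ≤ Real.exp ε * c2)
    (hμ0 : 0 ≤ μ) (hμ1 : μ ≤ 1) (hμc : c2 / (2 * c1) ≤ μ)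
    (ρ : ℝ) (hρ0 : 0 < ρ) (hρ1 : ρ < 1)
    (N : ℕ) (hN0 : 0 < N)
    (hN : (N : ℝ) ≥ 2 * (Real.exp ε - 1) ^ 2 * Real.log (2 / ρ) / ρ ^ 2) :
    (∑ M ∈ Finset.range (N + 1),
        (N.choose M : ℝ) * μ ^ M * (1 - μ) ^ (N - M) *
          klMrcMmrc c1 c2 μ ((M : ℝ) / (N : ℝ))
            (Finset.univ.filter fun k : Fin N => (k : ℕ) < M))
      ≤ ρ * (1 + ε) := by
  have hN' : (0 : ℝ) < N := by exact_mod_cast hN0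
  set D := Real.exp ε - 1 with hDdef
  have hND : D ^ 2 ≤ N * ρ ^ 2 := by
    have hlog : 1 / 2 ≤ Real.log (2 / ρ) := by
      have h2 : Real.log 2 ≤ Real.log (2 / ρ) :=
        Real.log_le_log two_pos (by rw [le_div_iff₀ hρ0]; linarith)
      linarith [Real.log_two_gt_d9]
    rw [ge_iff_le, div_le_iff₀ (by positivity)] at hN
    nlinarith [mul_le_mul_of_nonneg_left hlog (sq_nonneg D)]
  have hNρ : 0 < N * ρ := by positivity
  have hvar := sum_binomial_mul_sq_sub hμ0 hμ1 hN0
  calc _ ≤ ∑ M ∈ Finset.range (N + 1), (N.choose M : ℝ) * μ ^ M * (1 - μ) ^ (N - M) *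
        (2 * (N * ρ) * ((M : ℝ) / N - μ) ^ 2 + D ^ 2 / (2 * (N * ρ))) := by
        refine Finset.sum_le_sum fun M hM => mul_le_mul_of_nonneg_left ?_ ?_
        · have hMN : M ≤ N := Nat.lt_succ_iff.1 (Finset.mem_range.1 hM)
          refine (klMrcMmrc_le (D := D) _ hN0 hc2 hc12 (by rw [hDdef]; linarith) hμ0 hμ1 hμc
            (by positivity) ?_ ?_).trans ?_
          · rw [div_le_one hN']
            exact_mod_cast hMN
          · rw [mul_div_cancel₀ _ hN'.ne', Fin.card_filter_val_lt, min_eq_right hMN]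
          · rw [← sq_abs ((M : ℝ) / N - μ), ← sub_nonneg]
            have : 2 * (N * ρ) * |(M : ℝ) / N - μ| ^ 2 + D ^ 2 / (2 * (N * ρ)) -
                2 * D * |(M : ℝ) / N - μ| =
                (2 * (N * ρ) * |(M : ℝ) / N - μ| - D) ^ 2 / (2 * (N * ρ)) := by
              field_simp
              ring
            rw [this]
            positivity
        · have : 0 ≤ 1 - μ := sub_nonneg.2 hμ1
          positivity
    _ = 2 * ρ * (μ * (1 - μ)) + D ^ 2 / (2 * (N * ρ)) := by
        simp only [mul_add, Finset.sum_add_distrib, ← Finset.sum_mul, sum_binomial]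
        have : ∑ M ∈ Finset.range (N + 1), (N.choose M : ℝ) * μ ^ M * (1 - μ) ^ (N - M) *
            (2 * (N * ρ) * ((M : ℝ) / N - μ) ^ 2) = 2 * (N * ρ) * (μ * (1 - μ) / N) := by
          rw [← hvar, Finset.mul_sum]
          exact Finset.sum_congr rfl fun M _ => by ring
        rw [this]
        field_simp
    _ ≤ ρ / 2 + ρ / 2 := by
        refine add_le_add ?_ ?_
        · nlinarith [mul_nonneg hρ0.le (sq_nonneg (2 * μ - 1))]
        · rw [div_le_iff₀ (by positivity)]
          linarith
    _ ≤ ρ * (1 + ε) := by linarith [mul_nonneg hρ0.le hε]
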